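/- Let W be a symmetric n×n real matrix with zero diagonal whose node set [n] is partitioned into clusters V_1, ..., V_k and a set of stray nodes V_stray, such that every entry W_{ii'} with i, i' in distinct clusters is negative and every entry W_{vi} with v ∈ V_stray, i ≠ v is negative. Suppose that for each j ∈ [k] the submatrix W(V_j, V_j) can be written as q_j q_jᵀ − Diag(q_j ∘ q_j) + N_j, where: (1) q_j is an entrywise positive vector satisfying max_i q_j(i)^{4/3} ≤ ‖q_j^{∘2/3}‖² / 45; (2) letting U_j ⊆ V_j be the set of nodes of V_j incident (within V_j) to a negative entry of W(V_j, V_j), there exists S_j ⊆ V_j \ U_j such that for all u ∈ U_j and s ∈ S_j, |S_j| · q_j(s)^{1/3} · W_{us} ≥ −6 · Σ_{u' ∈ U_j : W_{uu'} < 0} q_j(u')^{1/3} W_{uu'}; (3) N_j is symmetric with zero diagonal and each of its rows nⁱ satisfies ‖nⁱ‖ ≤ q_j(i) ‖q_j^{∘2/3}‖² / (45 ‖q_j^{∘1/3}‖). Then the semidefinite program (P-ND): maximize ⟨W, X⟩ subject to X entrywise nonnegative, X positive semidefinite, and ‖diag(X)‖ ≤ 1, has an optimal solution X* satisfying X*_{ii'}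 > 0 if and only if i and i' belong to the same cluster V_j for some j ∈ [k]. -/

import Mathlib

/-- A function of a real variable that has a minimum over `[0, δ)` at `0` has nonnegative
derivative there. -/
theorem deriv_nonneg_of_min_right {φ : ℝ → ℝ} {g δ : ℝ} (hδ : 0 < δ) (hφ : HasDerivAt φ g 0)
    (hmin : ∀ t, 0 < t → t < δ → φ 0 ≤ φ t) : 0 ≤ g := by
  have h := hφ.tendsto_slope_zero_right
  refine ge_of_tendsto h ?_
  filter_upwards [Ioo_mem_nhdsGT hδ] with t ht
  have := hmin t ht.1 ht.2
  simp only [zero_add, smul_eq_mul]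
  exact mul_nonneg (inv_nonneg.mpr ht.1.le) (by linarith)

/-- The quartic energy whose critical points satisfy `x ^ 3 = W x`. -/
noncomputable def quarticEnergy {ι : Type*} [Fintype ι] (W : Matrix ι ι ℝ) (x : ι → ℝ) : ℝ :=
  ∑ a, x a ^ 4 / 4 - (∑ a, ∑ b, W a b * x a * x b) / 2

theorem continuous_quarticEnergy {ι : Type*} [Fintype ι] (W : Matrix ι ι ℝ) :
    Continuous (quarticEnergy W) := by
  unfold quarticEnergy
  fun_prop

theorem hasDerivAt_quarticEnergy {ι : Type*} [Fintype ι] [DecidableEq ι] {W : Matrix ι ι ℝ}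
    (hW : W.IsSymm) (x : ι → ℝ) (a : ι) (s : ℝ) :
    HasDerivAt (fun t : ℝ => quarticEnergy W (x + t • Pi.single a s))
      (s * (x a ^ 3 - ∑ b, W a b * x b)) 0 := by
  set d : ι → ℝ := Pi.single a s with hd
  have hlin : ∀ b, HasDerivAt (fun t : ℝ => (x + t • d) b) (d b) 0 := fun b => by
    simpa using ((hasDerivAt_id (0 : ℝ)).mul_const (d b)).const_add (x b)
  have h1 : HasDerivAt (fun t : ℝ => ∑ b, (x + t • d) b ^ 4 / 4) (∑ b, x b ^ 3 * d b) 0 := by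
    refine HasDerivAt.fun_sum fun b _ => ?_
    have := ((hlin b).pow 4).div_const 4
    refine this.congr_deriv ?_
    simp
    ring
  have h2 : HasDerivAt (fun t : ℝ => ∑ b, ∑ c, W b c * (x + t • d) b * (x + t • d) c)
      (∑ b, ∑ c, (W b c * d b * x c + W b c * x b * d c)) 0 := by
    refine HasDerivAt.fun_sum fun b _ => HasDerivAt.fun_sum fun c _ => ?_
    have := ((hlin b).const_mul (W b c)).mul (hlin c)
    refine this.congr_deriv ?_
    simp
  have h3 := h1.sub (h2.div_const 2)
  refine h3.congr_deriv ?_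
  have e1 : ∑ b, x b ^ 3 * d b = x a ^ 3 * s := by
    simp [hd, Pi.single_apply]
  have e2 : ∑ b, ∑ c, W b c * d b * x c = s * ∑ c, W a c * x c := by
    rw [Finset.sum_eq_single a]
    · simp only [hd, Pi.single_eq_same, Finset.mul_sum]
      exact Finset.sum_congr rfl fun c _ => by ring
    · intro b _ hb
      simp [hd, hb]
    · simp
  have e3 : ∑ b, ∑ c, W b c * x b * d c = s * ∑ c, W a c * x c := by
    rw [Finset.sum_comm, ← e2]
    refine Finset.sum_congr rfl fun b _ => Finset.sum_congr rfl fun c _ => ?_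
    rw [hW.apply b c]
    ring
  simp only [Finset.sum_add_distrib]
  rw [e1, e2, e3]
  ring

/-- If the field `x ^ 3 - W x` points outward on the faces of a box, it vanishes somewhere
in the box. -/
theorem exists_cube_eq_mulVec_of_box {ι : Type*} [Fintype ι] {W : Matrix ι ι ℝ}
    (hW : W.IsSymm) {l u : ι → ℝ} (hlu : ∀ a, l a < u a)
    (hl : ∀ x ∈ Set.Icc l u, ∀ a, x a = l a → x a ^ 3 < ∑ b, W a b * x b)
    (hu : ∀ x ∈ Set.Icc l u, ∀ a, x a = u a → ∑ b, W a b * x b < x a ^ 3) :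
    ∃ x ∈ Set.Icc l u, ∀ a, x a ^ 3 = ∑ b, W a b * x b := by
  classical
  obtain ⟨x, hx, hmin⟩ := (isCompact_Icc (a := l) (b := u)).exists_isMinOn
    (Set.nonempty_Icc.mpr fun a => (hlu a).le) (continuous_quarticEnergy W).continuousOn
  refine ⟨x, hx, fun a => ?_⟩
  have hup : x a < u a → 0 ≤ x a ^ 3 - ∑ b, W a b * x b := by
    intro h
    have hd := hasDerivAt_quarticEnergy hW x a 1
    rw [one_mul] at hd
    refine deriv_nonneg_of_min_right (sub_pos.mpr h) hd fun t ht0 ht => ?_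
    have : x + t • Pi.single a (1 : ℝ) ∈ Set.Icc l u := by
      constructor <;> intro b <;> by_cases hb : b = a
      · subst hb; simp; linarith [hx.1 b]
      · simpa [hb] using hx.1 b
      · subst hb; simp; linarith
      · simpa [hb] using hx.2 b
    simpa using hmin this
  have hdown : l a < x a → x a ^ 3 - ∑ b, W a b * x b ≤ 0 := by
    intro h
    have hd := hasDerivAt_quarticEnergy hW x a (-1)
    have := deriv_nonneg_of_min_right (sub_pos.mpr h) hd fun t ht0 ht => by
      have : x + t • Pi.single a (-1 : ℝ) ∈ Set.Icc l u := by
        constructor <;> intro b <;> by_cases hb : b = a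
        · subst hb; simp; linarith
        · simpa [hb] using hx.1 b
        · subst hb; simp; linarith [hx.2 b]
        · simpa [hb] using hx.2 b
      simpa using hmin this
    linarith
  have hlt : x a < u a := by
    refine lt_of_le_of_ne (hx.2 a) fun h => ?_
    have h1 := hu x hx a h
    have h2 := hdown (h ▸ hlu a)
    linarith
  have hgt : l a < x a := by
    refine lt_of_le_of_ne (hx.1 a) fun h => ?_
    have h1 := hl x hx a h.symm
    have h2 := hup hlt
    linarith
  linarith [hup hlt, hdown hgt]

/-- Weighted Frobenius bound for the quadratic form of a symmetric matrix with small rows. -/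
theorem abs_quadForm_le_of_row_bound {ι : Type*} [Fintype ι] {N : Matrix ι ι ℝ}
    (hN : N.IsSymm) {r : ι → ℝ} (hr : ∀ a, 0 < r a) {C : ℝ} (hC : 0 ≤ C)
    (hrow : ∀ a, (∑ b, N a b ^ 2) * ∑ b, r b ^ 2 ≤ r a ^ 6 * C ^ 2) (v : ι → ℝ) :
    |∑ a, ∑ b, N a b * v a * v b| ≤ C * ∑ a, r a ^ 2 * v a ^ 2 := by
  rcases isEmpty_or_nonempty ι with _ | _
  · simp
  have hQ : 0 < ∑ b, r b ^ 2 :=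
    Finset.sum_pos (fun b _ => pow_pos (hr b) 2) Finset.univ_nonempty
  have hfrob : ∑ a, ∑ b, (N a b / (r a * r b)) ^ 2 ≤ C ^ 2 := by
    have h1 : ∑ a, ∑ b, N a b ^ 2 / r a ^ 4 ≤ C ^ 2 := by
      have : ∀ a, ∑ b, N a b ^ 2 / r a ^ 4 ≤ r a ^ 2 * (C ^ 2 / ∑ b, r b ^ 2) := by
        intro a
        have := hr a
        rw [← Finset.sum_div, div_le_iff₀ (by positivity), mul_div_assoc', div_mul_eq_mul_div,
          le_div_iff₀ hQ]
        linarith [hrow a]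
      refine (Finset.sum_le_sum fun a _ => this a).trans ?_
      rw [← Finset.sum_mul, mul_div_cancel₀ _ hQ.ne']
    have h2 : ∑ a, ∑ b, N a b ^ 2 / r b ^ 4 = ∑ a, ∑ b, N a b ^ 2 / r a ^ 4 := by
      rw [Finset.sum_comm]
      refine Finset.sum_congr rfl fun a _ => Finset.sum_congr rfl fun b _ => ?_
      rw [hN.apply a b]
    have h3 : ∑ a, ∑ b, (N a b / (r a * r b)) ^ 2
        ≤ ∑ a, ∑ b, (N a b ^ 2 / r a ^ 4 + N a b ^ 2 / r b ^ 4) / 2 := by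
      refine Finset.sum_le_sum fun a _ => Finset.sum_le_sum fun b _ => ?_
      have ha := (hr a).ne'
      have hb := (hr b).ne'
      have : (N a b ^ 2 / r a ^ 4 + N a b ^ 2 / r b ^ 4) / 2 - (N a b / (r a * r b)) ^ 2
          = (N a b * (1 / r a ^ 2 - 1 / r b ^ 2)) ^ 2 / 2 := by
        field_simp
        ring
      have := sq_nonneg (N a b * (1 / r a ^ 2 - 1 / r b ^ 2))
      linarith
    simp only [← Finset.sum_div] at h1 h2
    simp only [← Finset.sum_div, Finset.sum_add_distrib] at h3
    rw [h2] at h3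
    linarith
  have hP : 0 ≤ ∑ a, r a ^ 2 * v a ^ 2 := Finset.sum_nonneg fun a _ => by positivity
  refine abs_le_of_sq_le_sq ?_ (mul_nonneg hC hP)
  have hcs := Finset.sum_mul_sq_le_sq_mul_sq (Finset.univ : Finset (ι × ι))
    (fun p => N p.1 p.2 / (r p.1 * r p.2)) (fun p => (r p.1 * v p.1) * (r p.2 * v p.2))
  simp only [Fintype.sum_prod_type] at hcs
  have e1 : ∑ a, ∑ b, N a b / (r a * r b) * ((r a * v a) * (r b * v b))
      = ∑ a, ∑ b, N a b * v a * v b := by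
    refine Finset.sum_congr rfl fun a _ => Finset.sum_congr rfl fun b _ => ?_
    have ha := (hr a).ne'
    have hb := (hr b).ne'
    field_simp
  have e2 : ∑ a, ∑ b, ((r a * v a) * (r b * v b)) ^ 2 = (∑ a, r a ^ 2 * v a ^ 2) ^ 2 := by
    rw [sq, Finset.sum_mul_sum]
    exact Finset.sum_congr rfl fun a _ => Finset.sum_congr rfl fun b _ => by ring
  rw [e1, e2] at hcs
  rw [mul_pow]
  exact hcs.trans (mul_le_mul_of_nonneg_right hfrob (sq_nonneg _))

/-- A perturbed rank-one cluster carries a positive vector `x` with `x ^ 3 = W x` for which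
`Diag (x ^ 2) - W` is positive semidefinite. -/
theorem exists_cluster_vector {ι : Type*} [Fintype ι] [DecidableEq ι] {W N : Matrix ι ι ℝ}
    {r : ι → ℝ} (hr : ∀ a, 0 < r a) (hN : N.IsSymm)
    (hW : ∀ a b, W a b = r a ^ 3 * r b ^ 3 - (if a = b then r a ^ 6 else 0) + N a b)
    (hmax : ∀ a, r a ^ 4 ≤ (∑ b, r b ^ 4) / 45)
    (hrow : ∀ a, √(∑ b, N a b ^ 2) * √(∑ b, r b ^ 2) ≤ r a ^ 3 * ((∑ b, r b ^ 4) / 45)) :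
    ∃ x : ι → ℝ, (∀ a, 0 < x a) ∧ (∀ a, x a ^ 3 = ∑ b, W a b * x b) ∧
      ∀ v : ι → ℝ, ∑ a, ∑ b, W a b * v a * v b ≤ ∑ a, x a ^ 2 * v a ^ 2 := by
  rcases isEmpty_or_nonempty ι with _ | _
  · exact ⟨0, by simp⟩
  set T := ∑ b, r b ^ 4 with hT
  have hTpos : 0 < T := Finset.sum_pos (fun b _ => pow_pos (hr b) 4) Finset.univ_nonempty
  set c := √T with hc
  have hcpos : 0 < c := Real.sqrt_pos.mpr hTpos
  have hcsq : c ^ 2 = T := Real.sq_sqrt hTpos.le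
  have hWsymm : W.IsSymm := by
    refine Matrix.IsSymm.ext fun a b => ?_
    rw [hW, hW, hN.apply a b]
    by_cases h : a = b
    · subst h; rfl
    · rw [if_neg h, if_neg (Ne.symm h)]; ring
  have hmul : ∀ (x : ι → ℝ) (a : ι), ∑ b, W a b * x b
      = r a ^ 3 * ∑ b, r b ^ 3 * x b - r a ^ 6 * x a + ∑ b, N a b * x b := by
    intro x a
    simp only [hW, add_mul, sub_mul, Finset.sum_add_distrib, Finset.sum_sub_distrib, ite_mul,
      zero_mul, Finset.sum_ite_eq, Finset.mem_univ, if_true, Finset.mul_sum, mul_assoc]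
  set l : ι → ℝ := fun a => 9 / 10 * (c * r a) with hl
  set u : ι → ℝ := fun a => 11 / 10 * (c * r a) with hu
  have hbounds : ∀ x ∈ Set.Icc l u, 9 / 10 * (c * T) ≤ ∑ b, r b ^ 3 * x b ∧
      ∑ b, r b ^ 3 * x b ≤ 11 / 10 * (c * T) ∧
      ∀ a, |∑ b, N a b * x b| ≤ 11 / 10 * (c * (r a ^ 3 * (T / 45))) := by
    intro x hx
    refine ⟨?_, ?_, fun a => ?_⟩
    · rw [hT, Finset.mul_sum, Finset.mul_sum]
      refine Finset.sum_le_sum fun b _ => ?_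
      have := mul_le_mul_of_nonneg_left (hx.1 b) (pow_pos (hr b) 3).le
      simp only [hl] at this
      linarith
    · rw [hT, Finset.mul_sum, Finset.mul_sum]
      refine Finset.sum_le_sum fun b _ => ?_
      have := mul_le_mul_of_nonneg_left (hx.2 b) (pow_pos (hr b) 3).le
      simp only [hu] at this
      linarith
    · have hcs := Finset.sum_mul_sq_le_sq_mul_sq Finset.univ (fun b => N a b) x
      have hx2 : ∑ b, x b ^ 2 ≤ (11 / 10 * c) ^ 2 * ∑ b, r b ^ 2 := by
        rw [Finset.mul_sum]
        refine Finset.sum_le_sum fun b _ => ?_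
        have hb := hx.2 b
        have hb0 : 0 ≤ x b := le_trans (by have := hr b; simp only [hl]; positivity) (hx.1 b)
        calc x b ^ 2 ≤ (11 / 10 * (c * r b)) ^ 2 := pow_le_pow_left₀ hb0 hb 2
          _ = _ := by ring
      calc |∑ b, N a b * x b| ≤ √((∑ b, N a b ^ 2) * ∑ b, x b ^ 2) := Real.abs_le_sqrt hcs
        _ ≤ √((∑ b, N a b ^ 2) * ((11 / 10 * c) ^ 2 * ∑ b, r b ^ 2)) := by
          refine Real.sqrt_le_sqrt (mul_le_mul_of_nonneg_left hx2 ?_)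
          exact Finset.sum_nonneg fun b _ => sq_nonneg _
        _ = 11 / 10 * c * (√(∑ b, N a b ^ 2) * √(∑ b, r b ^ 2)) := by
          rw [Real.sqrt_mul (Finset.sum_nonneg fun b _ => sq_nonneg _),
            Real.sqrt_mul (sq_nonneg _), Real.sqrt_sq (by positivity)]
          ring
        _ ≤ 11 / 10 * c * (r a ^ 3 * (T / 45)) :=
          mul_le_mul_of_nonneg_left (hrow a) (by positivity)
        _ = _ := by ring
  obtain ⟨x, hx, hfix⟩ := exists_cube_eq_mulVec_of_box (l := l) (u := u) hWsymm
    (fun a => by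
      have := mul_pos hcpos (hr a)
      simp only [hl, hu]
      linarith)
    (by
      intro x hx a ha
      obtain ⟨h1, -, h3⟩ := hbounds x hx
      have h3 := (abs_le.mp (h3 a)).1
      rw [hmul, ha]
      have hra := hr a
      have h4 := mul_le_mul_of_nonneg_left h1 (pow_pos hra 3).le
      have h5 := mul_le_mul_of_nonneg_left (hmax a) (by positivity : 0 ≤ c * r a ^ 3)
      have h6 : (l a) ^ 3 = 729 / 1000 * (c * r a ^ 3 * T) := by
        simp only [hl]; rw [← hcsq]; ring
      have h7 : r a ^ 6 * l a = 9 / 10 * (c * r a ^ 3 * r a ^ 4) := by simp only [hl]; ring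
      have h8 : 0 < c * r a ^ 3 * T := by positivity
      rw [h6, h7]
      linarith)
    (by
      intro x hx a ha
      obtain ⟨-, h2, h3⟩ := hbounds x hx
      have h3 := (abs_le.mp (h3 a)).2
      rw [hmul, ha]
      have hra := hr a
      have h4 := mul_le_mul_of_nonneg_left h2 (pow_pos hra 3).le
      have h6 : (u a) ^ 3 = 1331 / 1000 * (c * r a ^ 3 * T) := by
        simp only [hu]; rw [← hcsq]; ring
      have h7 : 0 < r a ^ 6 * u a := by simp only [hu]; positivity
      have h8 : 0 < c * r a ^ 3 * T := by positivity
      rw [h6]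
      linarith)
  have hxpos : ∀ a, 0 < x a := fun a =>
    lt_of_lt_of_le (by have := hr a; simp only [hl]; positivity) (hx.1 a)
  refine ⟨x, hxpos, hfix, fun v => ?_⟩
  have hpos : 0 < ∑ b, r b ^ 3 * x b :=
    Finset.sum_pos (fun b _ => mul_pos (pow_pos (hr b) 3) (hxpos b)) Finset.univ_nonempty
  -- shifting along the kernel vector `x` makes `v` orthogonal to `r ^ 3`
  set s := (∑ b, r b ^ 3 * v b) / ∑ b, r b ^ 3 * x b with hs
  set w : ι → ℝ := fun a => v a - s * x a with hw
  have hworth : ∑ b, r b ^ 3 * w b = 0 := by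
    have : ∑ b, r b ^ 3 * w b = ∑ b, r b ^ 3 * v b - s * ∑ b, r b ^ 3 * x b := by
      rw [Finset.mul_sum, ← Finset.sum_sub_distrib]
      exact Finset.sum_congr rfl fun b _ => by simp only [hw]; ring
    rw [this, hs, div_mul_cancel₀ _ hpos.ne', sub_self]
  have hcross : ∀ z : ι → ℝ, ∑ a, z a * ∑ b, W a b * x b = ∑ a, x a * ∑ b, W a b * z b := by
    intro z
    simp only [Finset.mul_sum]
    rw [Finset.sum_comm]
    refine Finset.sum_congr rfl fun a _ => Finset.sum_congr rfl fun b _ => ?_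
    rw [hWsymm.apply a b]
    ring
  have hquad : ∀ z : ι → ℝ, ∑ a, ∑ b, W a b * z a * z b = ∑ a, z a * ∑ b, W a b * z b := by
    intro z
    simp only [Finset.mul_sum]
    exact Finset.sum_congr rfl fun a _ => Finset.sum_congr rfl fun b _ => by ring
  have hshift : ∑ a, x a ^ 2 * v a ^ 2 - ∑ a, ∑ b, W a b * v a * v b
      = ∑ a, x a ^ 2 * w a ^ 2 - ∑ a, ∑ b, W a b * w a * w b := by
    have hWw : ∀ a, ∑ b, W a b * v b = ∑ b, W a b * w b + s * x a ^ 3 := by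
      intro a
      rw [hfix, Finset.mul_sum, ← Finset.sum_add_distrib]
      exact Finset.sum_congr rfl fun b _ => by simp only [hw]; ring
    have hxw : ∑ a, x a * ∑ b, W a b * w b = ∑ a, w a * x a ^ 3 := by
      rw [← hcross]
      exact Finset.sum_congr rfl fun a _ => by rw [hfix]
    rw [hquad, hquad]
    simp only [hWw]
    have : ∑ a, v a * (∑ b, W a b * w b + s * x a ^ 3)
        = ∑ a, w a * ∑ b, W a b * w b + s * ∑ a, x a * ∑ b, W a b * w b
          + s * ∑ a, v a * x a ^ 3 := by
      simp only [Finset.mul_sum (a := s), ← Finset.sum_add_distrib]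
      refine Finset.sum_congr rfl fun a _ => ?_
      have : v a = w a + s * x a := by simp only [hw]; ring
      rw [this]
      ring
    rw [this, hxw]
    have : ∑ a, x a ^ 2 * v a ^ 2 = ∑ a, x a ^ 2 * w a ^ 2 + s * ∑ a, w a * x a ^ 3
        + s * ∑ a, v a * x a ^ 3 := by
      simp only [Finset.mul_sum (a := s), ← Finset.sum_add_distrib]
      exact Finset.sum_congr rfl fun a _ => by simp only [hw]; ring
    rw [this]
    ring
  have hNw := abs_quadForm_le_of_row_bound hN hr (C := T / 45) (by positivity) (fun a => by
    have h := pow_le_pow_left₀ (by positivity) (hrow a) 2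
    rw [mul_pow, Real.sq_sqrt (Finset.sum_nonneg fun b _ => sq_nonneg _),
      Real.sq_sqrt (Finset.sum_nonneg fun b _ => sq_nonneg _)] at h
    calc _ ≤ _ := h
      _ = _ := by ring) w
  have hWform : ∑ a, ∑ b, W a b * w a * w b
      = -∑ a, r a ^ 6 * w a ^ 2 + ∑ a, ∑ b, N a b * w a * w b := by
    rw [hquad]
    simp only [hmul, hworth]
    rw [← Finset.sum_neg_distrib, ← Finset.sum_add_distrib]
    refine Finset.sum_congr rfl fun a _ => ?_
    rw [mul_add, Finset.mul_sum]
    congr 1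
    · ring
    · exact Finset.sum_congr rfl fun b _ => by ring
  have hdiag : 81 / 100 * T * ∑ a, r a ^ 2 * w a ^ 2 ≤ ∑ a, x a ^ 2 * w a ^ 2 := by
    rw [Finset.mul_sum]
    refine Finset.sum_le_sum fun a _ => ?_
    have h0 : 0 ≤ l a := by have := hr a; simp only [hl]; positivity
    calc 81 / 100 * T * (r a ^ 2 * w a ^ 2) = l a ^ 2 * w a ^ 2 := by
          simp only [hl]; rw [← hcsq]; ring
      _ ≤ x a ^ 2 * w a ^ 2 :=
          mul_le_mul_of_nonneg_right (pow_le_pow_left₀ h0 (hx.1 a) 2) (sq_nonneg _)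
  have hr6 : 0 ≤ ∑ a, r a ^ 6 * w a ^ 2 := Finset.sum_nonneg fun a _ => by
    have := hr a; positivity
  have hP : 0 ≤ T * ∑ a, r a ^ 2 * w a ^ 2 :=
    mul_nonneg hTpos.le (Finset.sum_nonneg fun a _ => by positivity)
  have := (abs_le.mp hNw).2
  linarith

/-- A quadratic inequality extends from vectors to positive semidefinite matrices. -/
theorem sum_mul_le_sum_diag_of_posSemidef {ι : Type*} [Fintype ι] {A X : Matrix ι ι ℝ}
    {d : ι → ℝ} (hA : ∀ v : ι → ℝ, ∑ a, ∑ b, A a b * v a * v b ≤ ∑ a, d a * v a ^ 2)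
    (hX : X.PosSemidef) : ∑ a, ∑ b, A a b * X a b ≤ ∑ a, d a * X a a := by
  obtain ⟨m, v, rfl⟩ := Matrix.posSemidef_iff_eq_sum_vecMulVec.mp hX
  have hentry : ∀ a b, (∑ i, Matrix.vecMulVec (v i) (star (v i))) a b = ∑ i, v i a * v i b := by
    intro a b
    simp [Matrix.sum_apply, Matrix.vecMulVec_apply]
  simp only [hentry]
  calc ∑ a, ∑ b, A a b * ∑ i, v i a * v i b
      = ∑ i, ∑ a, ∑ b, A a b * v i a * v i b := by
        simp only [Finset.mul_sum, ← mul_assoc]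
        rw [Finset.sum_comm]
        conv_rhs => rw [Finset.sum_comm]; enter [2, a]; rw [Finset.sum_comm]
        exact Finset.sum_comm
    _ ≤ ∑ i, ∑ a, d a * v i a ^ 2 := Finset.sum_le_sum fun i _ => hA (v i)
    _ = ∑ a, d a * ∑ i, v i a * v i a := by
        rw [Finset.sum_comm]
        exact Finset.sum_congr rfl fun a _ => by
          rw [Finset.mul_sum]
          exact Finset.sum_congr rfl fun i _ => by ring

/-- The restriction of a matrix to a principal block, extended by zero. -/
def blockMask {ι : Type*} [DecidableEq ι] (W : Matrix ι ι ℝ) (s : Finset ι) : Matrix ι ι ℝ :=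
  fun i i' => if i ∈ s ∧ i' ∈ s then W i i' else 0

theorem sum_blockMask_mul {ι : Type*} [Fintype ι] [DecidableEq ι] (W : Matrix ι ι ℝ)
    (s : Finset ι) {i : ι} (hi : i ∈ s) (f : ι → ℝ) :
    ∑ b, blockMask W s i b * f b = ∑ b : {x // x ∈ s}, W i b * f b := by
  rw [Finset.sum_coe_sort s fun b => W i b * f b, ← Finset.sum_subset (Finset.subset_univ s)]
  · exact Finset.sum_congr rfl fun b hb => by simp [blockMask, hi, hb]
  · intro b _ hb
    simp [blockMask, hb]

theorem sum_eq_sum_subtype {ι : Type*} [Fintype ι] (s : Finset ι) (f : ι → ℝ)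
    (hf : ∀ i ∉ s, f i = 0) : ∑ i, f i = ∑ i : {x // x ∈ s}, f i := by
  rw [Finset.sum_coe_sort s f, Finset.sum_subset (Finset.subset_univ s)]
  exact fun i _ hi => hf i hi

/-- Extension by zero of a cluster vector. -/
theorem exists_extended_cluster_vector {ι : Type*} [Fintype ι] [DecidableEq ι]
    (W : Matrix ι ι ℝ) (s : Finset ι)
    (h : ∃ x : {x // x ∈ s} → ℝ, (∀ a, 0 < x a) ∧ (∀ a, x a ^ 3 = ∑ b, W a.1 b.1 * x b) ∧
      ∀ v : {x // x ∈ s} → ℝ, ∑ a, ∑ b, W a.1 b.1 * v a * v b ≤ ∑ a, x a ^ 2 * v a ^ 2) :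
    ∃ y : ι → ℝ, (∀ i ∈ s, 0 < y i) ∧ (∀ i ∉ s, y i = 0) ∧
      (∀ i, y i ^ 3 = ∑ b, blockMask W s i b * y b) ∧
      ∀ v : ι → ℝ, ∑ a, ∑ b, blockMask W s a b * v a * v b ≤ ∑ a, y a ^ 2 * v a ^ 2 := by
  obtain ⟨x, hpos, hfix, hpsd⟩ := h
  have hy : ∀ a : {x // x ∈ s}, (if h : a.1 ∈ s then x ⟨a.1, h⟩ else 0) = x a := fun a => by
    simp [a.2]
  refine ⟨fun i => if h : i ∈ s then x ⟨i, h⟩ else 0, fun i hi => ?_, fun i hi => ?_,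
    fun i => ?_, fun v => ?_⟩
  · simpa [hi] using hpos ⟨i, hi⟩
  · simp [hi]
  · by_cases hi : i ∈ s
    · rw [sum_blockMask_mul W s hi]
      simp only [hy]
      simpa [hi] using hfix ⟨i, hi⟩
    · simp [blockMask, hi]
  · rw [sum_eq_sum_subtype s, sum_eq_sum_subtype s]
    · simp only [hy]
      refine le_of_eq_of_le (Finset.sum_congr rfl fun a _ => ?_) (hpsd fun a => v a)
      have := sum_blockMask_mul W s a.2 fun b => v a * v b
      simpa only [mul_assoc] using this
    · intro i hi
      simp [hi]
    · intro i hi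
      simp [blockMask, hi]

/-- Block rank-one vectors satisfying the dual certificate give an optimal solution of the
semidefinite program with the diagonal constraint `‖diag X‖ ≤ 1`. -/
theorem exists_optimal_of_cluster_vectors {ι κ : Type*} [Fintype ι] [DecidableEq ι] [Fintype κ]
    {W : Matrix ι ι ℝ} {V : κ → Finset ι}
    (hdisj : ∀ j j', j ≠ j' → Disjoint (V j) (V j'))
    (hoff : ∀ i i', (¬ ∃ j, i ∈ V j ∧ i' ∈ V j) → W i i' ≤ 0)
    {y : κ → ι → ℝ} (hpos : ∀ j, ∀ i ∈ V j, 0 < y j i) (hzero : ∀ j, ∀ i ∉ V j, y j i = 0)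
    (hfix : ∀ j i, y j i ^ 3 = ∑ b, blockMask W (V j) i b * y j b)
    (hpsd : ∀ j (v : ι → ℝ),
      ∑ a, ∑ b, blockMask W (V j) a b * v a * v b ≤ ∑ a, y j a ^ 2 * v a ^ 2) :
    ∃ Xstar : Matrix ι ι ℝ,
      ((∀ i i', 0 ≤ Xstar i i') ∧ Xstar.PosSemidef ∧ √(∑ i, (Xstar i i) ^ 2) ≤ 1) ∧
      (∀ X : Matrix ι ι ℝ,
        (∀ i i', 0 ≤ X i i') → X.PosSemidef → √(∑ i, (X i i) ^ 2) ≤ 1 →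
        ∑ i, ∑ i', W i i' * X i i' ≤ ∑ i, ∑ i', W i i' * Xstar i i') ∧
      (∀ i i', 0 < Xstar i i' ↔ ∃ j, i ∈ V j ∧ i' ∈ V j) := by
  have huniq : ∀ {j j' i}, i ∈ V j → i ∈ V j' → j' = j := by
    intro j j' i h h'
    by_contra hne
    exact Finset.disjoint_left.mp (hdisj j' j hne) h' h
  have hnonneg : ∀ j i, 0 ≤ y j i := fun j i => by
    by_cases h : i ∈ V j
    · exact (hpos j i h).le
    · exact (hzero j i h).ge
  set d : ι → ℝ := fun i => ∑ j, y j i ^ 2 with hd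
  have hdeq : ∀ {j i}, i ∈ V j → d i = y j i ^ 2 := by
    intro j i hi
    refine Finset.sum_eq_single j (fun j' _ hne => ?_) (by simp)
    rw [hzero j' i fun h => hne (huniq hi h), zero_pow two_ne_zero]
  have hdnonneg : ∀ i, 0 ≤ d i := fun i => Finset.sum_nonneg fun j _ => sq_nonneg _
  set R := √(∑ i, d i ^ 2) with hR
  have hRnonneg : 0 ≤ R := Real.sqrt_nonneg _
  have hRsq : R ^ 2 = ∑ i, d i ^ 2 := Real.sq_sqrt (Finset.sum_nonneg fun i _ => sq_nonneg _)
  have hRpos : ∀ {j i}, i ∈ V j → 0 < R := by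
    intro j i hi
    refine Real.sqrt_pos.mpr (Finset.sum_pos' (fun i _ => sq_nonneg _) ⟨i, Finset.mem_univ i, ?_⟩)
    rw [hdeq hi]
    have := hpos j i hi
    positivity
  set Y : Matrix ι ι ℝ := ∑ j, Matrix.vecMulVec (y j) (star (y j)) with hY
  have hYapp : ∀ i i', Y i i' = ∑ j, y j i * y j i' := fun i i' => by
    simp [hY, Matrix.sum_apply, Matrix.vecMulVec_apply]
  have hYdiag : ∀ i, Y i i = d i := fun i => by
    rw [hYapp]
    exact Finset.sum_congr rfl fun j _ => (sq _).symm
  have hYnonneg : ∀ i i', 0 ≤ Y i i' := fun i i' => by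
    rw [hYapp]
    exact Finset.sum_nonneg fun j _ => mul_nonneg (hnonneg j i) (hnonneg j i')
  have hYpsd : Y.PosSemidef :=
    Matrix.posSemidef_sum _ fun j _ => Matrix.posSemidef_vecMulVec_self_star (y j)
  have hYobj : ∑ i, ∑ i', W i i' * Y i i' = R ^ 2 := by
    have hblock : ∀ i i' j, W i i' * (y j i * y j i')
        = y j i * (blockMask W (V j) i i' * y j i') := by
      intro i i' j
      by_cases h : i ∈ V j ∧ i' ∈ V j
      · simp only [blockMask, if_pos h]; ring
      · rcases not_and_or.mp h with h' | h' <;> simp [hzero j _ h']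
    rw [hRsq]
    refine Finset.sum_congr rfl fun i _ => ?_
    simp only [hYapp, Finset.mul_sum, hblock]
    rw [Finset.sum_comm]
    simp only [← Finset.mul_sum, ← hfix]
    by_cases hi : ∃ j, i ∈ V j
    · obtain ⟨j, hj⟩ := hi
      rw [hdeq hj, Finset.sum_eq_single j]
      · ring
      · intro j' _ hne
        rw [hzero j' i fun h => hne (huniq hj h), zero_mul]
      · simp
    · have : ∀ j, y j i = 0 := fun j => hzero j i fun h => hi ⟨j, h⟩
      simp [hd, this]
  have hupper : ∀ X : Matrix ι ι ℝ, (∀ i i', 0 ≤ X i i') → X.PosSemidef →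
      √(∑ i, (X i i) ^ 2) ≤ 1 → ∑ i, ∑ i', W i i' * X i i' ≤ R := by
    intro X hX0 hXpsd hX1
    have hWle : ∀ i i', W i i' ≤ ∑ j, blockMask W (V j) i i' := by
      intro i i'
      by_cases h : ∃ j, i ∈ V j ∧ i' ∈ V j
      · obtain ⟨j, hj⟩ := h
        rw [Finset.sum_eq_single j]
        · simp [blockMask, hj]
        · intro j' _ hne
          simp [blockMask, show i ∉ V j' from fun h => hne (huniq hj.1 h)]
        · simp
      · rw [Finset.sum_eq_zero]
        · exact hoff i i' h
        · exact fun j _ => if_neg fun hj => h ⟨j, hj⟩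
    calc ∑ i, ∑ i', W i i' * X i i'
        ≤ ∑ i, ∑ i', (∑ j, blockMask W (V j) i i') * X i i' :=
          Finset.sum_le_sum fun i _ => Finset.sum_le_sum fun i' _ =>
            mul_le_mul_of_nonneg_right (hWle i i') (hX0 i i')
      _ = ∑ j, ∑ i, ∑ i', blockMask W (V j) i i' * X i i' := by
          simp only [Finset.sum_mul]
          conv_rhs => rw [Finset.sum_comm]; enter [2, a]; rw [Finset.sum_comm]
      _ ≤ ∑ j, ∑ i, y j i ^ 2 * X i i :=
          Finset.sum_le_sum fun j _ => sum_mul_le_sum_diag_of_posSemidef (hpsd j) hXpsd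
      _ = ∑ i, d i * X i i := by
          rw [Finset.sum_comm]
          simp only [hd, Finset.sum_mul]
      _ ≤ R * √(∑ i, (X i i) ^ 2) := Real.sum_mul_le_sqrt_mul_sqrt _ _ _
      _ ≤ R := mul_le_of_le_one_right hRnonneg hX1
  refine ⟨R⁻¹ • Y, ⟨fun i i' => ?_, hYpsd.smul (inv_nonneg.mpr hRnonneg), ?_⟩, ?_, fun i i' => ?_⟩
  · exact mul_nonneg (inv_nonneg.mpr hRnonneg) (hYnonneg i i')
  · have : ∑ i, ((R⁻¹ • Y) i i) ^ 2 = (R⁻¹ * R) ^ 2 := by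
      simp only [Matrix.smul_apply, hYdiag, smul_eq_mul, mul_pow, ← Finset.mul_sum, hRsq]
    rw [this, Real.sqrt_sq (mul_nonneg (inv_nonneg.mpr hRnonneg) hRnonneg)]
    exact inv_mul_le_one
  · intro X hX0 hXpsd hX1
    refine (hupper X hX0 hXpsd hX1).trans_eq ?_
    have : ∑ i, ∑ i', W i i' * (R⁻¹ • Y) i i' = R⁻¹ * ∑ i, ∑ i', W i i' * Y i i' := by
      simp only [Finset.mul_sum, Matrix.smul_apply, smul_eq_mul]
      exact Finset.sum_congr rfl fun i _ => Finset.sum_congr rfl fun i' _ => by ring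
    rw [this, hYobj]
    rcases hRnonneg.eq_or_lt with h | h
    · simp [← h]
    · field_simp
  · rw [Matrix.smul_apply, smul_eq_mul]
    constructor
    · intro h
      by_contra hcon
      have hY0 : Y i i' = 0 := by
        rw [hYapp]
        refine Finset.sum_eq_zero fun j _ => ?_
        rcases not_and_or.mp (fun hj => hcon ⟨j, hj⟩) with h' | h' <;> simp [hzero j _ h']
      simp [hY0] at h
    · rintro ⟨j, hi, hi'⟩
      have hprod := mul_pos (hpos j i hi) (hpos j i' hi')
      refine mul_pos (inv_pos.mpr (hRpos hi)) ?_
      rw [hYapp]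
      exact Finset.sum_pos' (fun j _ => mul_nonneg (hnonneg j i) (hnonneg j i'))
        ⟨j, Finset.mem_univ j, hprod⟩


/-- Under the NFM-style structural assumptions (clusters negatively
separated, strays negatively connected, and each cluster block admitting a
decomposition `q qᵀ - Diag(q ∘ q) + N` satisfying conditions (1)-(3) of
Assumption nd-as), the SDP (P-ND)
(maximize ⟨W, X⟩ s.t. X ≥ 0 entrywise, X ⪰ 0, ‖diag(X)‖ ≤ 1)
has an optimal solution `X*` with `X*_{ii'} > 0` iff `i, i'` lie in the same cluster. -/
theorem stmt_5 (n k : ℕ) (W : Matrix (Fin n) (Fin n) ℝ)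
    (hWsym : W.IsSymm) (hWdiag : ∀ i, W i i = 0)
    (V : Fin k → Finset (Fin n)) (Vstray : Finset (Fin n))
    (hcover : ∀ i : Fin n, i ∈ Vstray ∨ ∃ j, i ∈ V j)
    (hdisj : ∀ j j' : Fin k, j ≠ j' → Disjoint (V j) (V j'))
    (hstraydisj : ∀ j : Fin k, Disjoint (V j) Vstray)
    (hneg : ∀ (j j' : Fin k) (i i' : Fin n), j ≠ j' → i ∈ V j → i' ∈ V j' → W i i' < 0)
    (hstray : ∀ v ∈ Vstray, ∀ i : Fin n, i ≠ v → W v i < 0)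
    -- the decomposition W(V_j, V_j) = q_j q_jᵀ - Diag(q_j ∘ q_j) + N_j
    (q : ∀ j : Fin k, {x // x ∈ V j} → ℝ)
    (N : ∀ j : Fin k, Matrix {x // x ∈ V j} {x // x ∈ V j} ℝ)
    (hdecomp : ∀ j : Fin k,
      Matrix.of (fun a b : {x // x ∈ V j} => W a.1 b.1) =
        Matrix.of (fun a b : {x // x ∈ V j} => q j a * q j b)
          - Matrix.diagonal (fun a : {x // x ∈ V j} => q j a * q j a) + N j)
    -- condition (1): q_j positive and max q_j(i)^{4/3} ≤ ‖q_j^{∘2/3}‖²/45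
    (hqpos : ∀ (j : Fin k) (a : {x // x ∈ V j}), 0 < q j a)
    (hqmax : ∀ (j : Fin k) (a : {x // x ∈ V j}),
      q j a ^ ((4 : ℝ) / 3) ≤ (∑ b : {x // x ∈ V j}, (q j b ^ ((2 : ℝ) / 3)) ^ 2) / 45)
    -- condition (2): the combinatorial condition with the set S_j ⊆ V_j \ U_j
    (S : ∀ j : Fin k, Finset {x // x ∈ V j})
    (hSU : ∀ j : Fin k, ∀ s ∈ S j, ¬ ∃ w : {x // x ∈ V j}, W s.1 w.1 < 0)
    (hcond : ∀ (j : Fin k) (u : {x // x ∈ V j}),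
      (∃ w : {x // x ∈ V j}, W u.1 w.1 < 0) → ∀ s ∈ S j,
      ((S j).card : ℝ) * q j s ^ ((1 : ℝ) / 3) * W u.1 s.1 ≥
        -6 * ∑ u' ∈ Finset.univ.filter (fun u' : {x // x ∈ V j} => W u.1 u'.1 < 0),
          q j u' ^ ((1 : ℝ) / 3) * W u.1 u'.1)
    -- condition (3): N_j symmetric, zero diagonal, small rows
    (hNsym : ∀ j : Fin k, (N j).IsSymm)
    (hNdiag : ∀ (j : Fin k) (a : {x // x ∈ V j}), N j a a = 0)
    (hNrow : ∀ (j : Fin k) (a : {x // x ∈ V j}),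
      Real.sqrt (∑ b : {x // x ∈ V j}, (N j a b) ^ 2) ≤
        q j a * (∑ b : {x // x ∈ V j}, (q j b ^ ((2 : ℝ) / 3)) ^ 2) /
          (45 * Real.sqrt (∑ b : {x // x ∈ V j}, (q j b ^ ((1 : ℝ) / 3)) ^ 2))) :
    ∃ Xstar : Matrix (Fin n) (Fin n) ℝ,
      -- X* is feasible for (P-ND)
      ((∀ i i', 0 ≤ Xstar i i') ∧ Xstar.PosSemidef ∧
        Real.sqrt (∑ i, (Xstar i i) ^ 2) ≤ 1) ∧
      -- X* is optimal
      (∀ X : Matrix (Fin n) (Fin n) ℝ,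
        (∀ i i', 0 ≤ X i i') → X.PosSemidef → Real.sqrt (∑ i, (X i i) ^ 2) ≤ 1 →
        ∑ i, ∑ i', W i i' * X i i' ≤ ∑ i, ∑ i', W i i' * Xstar i i') ∧
      -- and X*_{ii'} > 0 iff i and i' lie in the same cluster
      (∀ i i' : Fin n, 0 < Xstar i i' ↔ ∃ j, i ∈ V j ∧ i' ∈ V j) := by
  classical
  have hcluster : ∀ j : Fin k, ∃ y : Fin n → ℝ, (∀ i ∈ V j, 0 < y i) ∧ (∀ i ∉ V j, y i = 0) ∧
      (∀ i, y i ^ 3 = ∑ b, blockMask W (V j) i b * y b) ∧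
      ∀ v : Fin n → ℝ,
        ∑ a, ∑ b, blockMask W (V j) a b * v a * v b ≤ ∑ a, y a ^ 2 * v a ^ 2 := by
    intro j
    have hpow : ∀ (a : {x // x ∈ V j}) (m : ℕ),
        (q j a ^ ((1 : ℝ) / 3)) ^ m = q j a ^ ((m : ℝ) / 3) := by
      intro a m
      rw [← Real.rpow_natCast, ← Real.rpow_mul (hqpos j a).le]
      congr 1
      ring
    have h3 : ∀ a : {x // x ∈ V j}, (q j a ^ ((1 : ℝ) / 3)) ^ 3 = q j a := fun a => by
      rw [hpow]; norm_num
    have h4 : ∀ a : {x // x ∈ V j},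
        (q j a ^ ((1 : ℝ) / 3)) ^ 4 = (q j a ^ ((2 : ℝ) / 3)) ^ 2 := fun a => by
      rw [show (4 : ℕ) = 2 * 2 from rfl, pow_mul, hpow]; norm_num
    have hr : ∀ a : {x // x ∈ V j}, 0 < q j a ^ ((1 : ℝ) / 3) := fun a =>
      Real.rpow_pos_of_pos (hqpos j a) _
    refine exists_extended_cluster_vector W (V j) (exists_cluster_vector
      (W := Matrix.of fun a b : {x // x ∈ V j} => W a.1 b.1) hr (hNsym j) (fun a b => ?_)
      (fun a => ?_) fun a => ?_)
    · rw [hdecomp j, show (6 : ℕ) = 3 * 2 from rfl, pow_mul, h3, h3]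
      simp [Matrix.diagonal_apply, sq]
    · simp only [h4]
      rw [← h4, hpow]
      exact_mod_cast hqmax j a
    · have hQ : 0 < ∑ b : {x // x ∈ V j}, (q j b ^ ((1 : ℝ) / 3)) ^ 2 :=
        Finset.sum_pos (fun b _ => pow_pos (hr b) 2) ⟨a, Finset.mem_univ a⟩
      have hrow := hNrow j a
      rw [le_div_iff₀ (mul_pos (by norm_num) (Real.sqrt_pos.mpr hQ))] at hrow
      simp only [h4, h3]
      linarith
  choose y hpos hzero hfix hpsd using hcluster
  refine exists_optimal_of_cluster_vectors hdisj (fun i i' hii => ?_) hpos hzero hfix hpsd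
  by_cases heq : i = i'
  · rw [heq, hWdiag]
  rcases hcover i with hi | ⟨j, hj⟩
  · exact (hstray i hi i' (Ne.symm heq)).le
  rcases hcover i' with hi' | ⟨j', hj'⟩
  · rw [← hWsym.apply]
    exact (hstray i' hi' i heq).le
  · refine (hneg j j' i i' (fun h => hii ⟨j, hj, ?_⟩) hj hj').le
    rwa [h]
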